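/- arXiv:2006.06736 — 2 statements merged into one kernel-verified Lean document; each statement's English description precedes it below -/
import Mathlib

section
/- Let A be a unital complex Banach algebra, λ ∈ ℂ nonzero, and a, b, c ∈ A satisfy a(ba)² = abaca = acaba = (ac)²a. Then λ - ba has a generalized Drazin inverse if and only if λ - ac has a generalized Drazin inverse. -/
def IsQuasinilpotent {A : Type*} [Ring A] (q : A) : Prop :=
  ∀ y : A, q * y = y * q → IsUnit (1 + q * y)

def IsGDrazinInverse {A : Type*} [Ring A] (a x : A) : Prop :=
  x = x * a * x ∧ a * x = x * a ∧ IsQuasinilpotent (a - a * a * x)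

def GDP {A : Type*} [Ring A] (u p z : A) : Prop :=
  p * p = p ∧ u * p = p * u ∧ u * z = 1 - p ∧ z * u = 1 - p ∧ IsQuasinilpotent (u * p)

theorem gdp_of_gd {A : Type*} [Ring A] (u x : A) (h : IsGDrazinInverse u x) :
    GDP u (1 - u * x) x := by
  obtain ⟨h1, h2, h3⟩ := h
  refine ⟨?_, ?_, ?_, ?_, ?_⟩
  · linear_combination (norm := noncomm_ring) -u * h1
  · linear_combination (norm := noncomm_ring) -u * h2
  · noncomm_ring
  · rw [h2]; noncomm_ring
  · have : u * (1 - u * x) = u - u * u * x := by noncomm_ring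
    rw [this]; exact h3

theorem gd_of_gdp {A : Type*} [Ring A] (u p z : A) (h : GDP u p z) :
    IsGDrazinInverse u (z * u * z) := by
  obtain ⟨h1, h2, h3, h4, h5⟩ := h
  have e1 : u * (z * u * z) = 1 - p := by
    have : u * (z * u * z) = (u * z) * (u * z) := by noncomm_ring
    rw [this, h3]; linear_combination (norm := noncomm_ring) h1
  have e2 : (z * u * z) * u = 1 - p := by
    have : (z * u * z) * u = (z * u) * (z * u) := by noncomm_ring
    rw [this, h4]; linear_combination (norm := noncomm_ring) h1
  refine ⟨?_, ?_, ?_⟩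
  · rw [e2]
    have : (1 - p) * (z * u * z) = (1 - p) * (1 - p) * z := by rw [h4]; noncomm_ring
    rw [this, h4]; linear_combination (norm := noncomm_ring) -h1 * z
  · rw [e1, e2]
  · have : u - u * u * (z * u * z) = u * p := by
      rw [mul_assoc u u, e1]; noncomm_ring
    rw [this]; exact h5

theorem isUnit_swap {A : Type*} [Ring A] (s t : A) (h : IsUnit (1 - s * t)) :
    IsUnit (1 - t * s) := by
  obtain ⟨w, h1, h2⟩ := isUnit_iff_exists.mp h
  refine isUnit_iff_exists.mpr ⟨1 + t * w * s, ?_, ?_⟩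
  · linear_combination (norm := noncomm_ring) t * h1 * s
  · linear_combination (norm := noncomm_ring) t * h2 * s

theorem qn_swap {A : Type*} [Ring A] (s t : A) (h : IsQuasinilpotent (s * t)) :
    IsQuasinilpotent (t * s) := by
  intro y hy
  have k := h (-(s * y * y * t)) (by
    linear_combination (norm := noncomm_ring) - s * hy * y * t - s * y * hy * t)
  have k1 : IsUnit (1 - s * (t * s * y * y * t)) := by
    convert k using 1; noncomm_ring
  have k2 := isUnit_swap _ _ k1
  have c : Commute (1 + t * s * y) (1 - t * s * y) := by
    unfold Commute SemiconjBy; noncomm_ring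
  have k3 : (1 + t * s * y) * (1 - t * s * y) = 1 - t * s * y * y * t * s := by
    linear_combination (norm := noncomm_ring) -(t * s * y * hy)
  rw [← k3] at k2
  exact (c.isUnit_mul_iff.mp k2).1

/-- the inverse of `1 - u` on the range of `p` -/
theorem gdp_v {A : Type*} [Ring A] (u p z : A) (h : GDP u p z) :
    ∃ v, v * p = p * v ∧ v * u = u * v ∧ (1 - u) * p * v = p := by
  obtain ⟨h1, h2, h3, h4, h5⟩ := h
  have k := h5 (-1) (by noncomm_ring)
  obtain ⟨w, w1, w2⟩ := isUnit_iff_exists.mp k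
  have hw : ∀ t, t * (u * p) = (u * p) * t → w * t = t * w := by
    intro t ht
    linear_combination (norm := noncomm_ring) - w * t * w1 + w2 * t * w - w * ht * w
  refine ⟨w, hw p ?_, hw u ?_, ?_⟩
  · linear_combination (norm := noncomm_ring) - h2 * p
  · linear_combination (norm := noncomm_ring) u * h2
  · linear_combination (norm := noncomm_ring) p * w1 - h2 * p * w + u * h1 * w
      

theorem jac {A : Type*} [Ring A] (a b p z : A) (h : GDP (1 - b * a) p z) :
    ∃ q x, GDP (1 - a * b) q x := by
  obtain ⟨v, v1, v2, v3⟩ := gdp_v _ _ _ h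
  obtain ⟨h1, h2, h3, h4, h5⟩ := h
  have v3' : b * a * p * v = p := by linear_combination (norm := noncomm_ring) v3
  have v2' : v * b * a = b * a * v := by linear_combination (norm := noncomm_ring) -v2
  have h2' : p * b * a = b * a * p := by linear_combination (norm := noncomm_ring) h2
  have v4 : p * v * b * a = p := by
    linear_combination (norm := noncomm_ring) v3' + p * v2' + h2' * v
  refine ⟨a * p * v * b, 1 + a * (z - p * v) * b, ?_, ?_, ?_, ?_, ?_⟩
  · linear_combination (norm := noncomm_ring) a * v4 * p * v * b + a * h1 * v * b
  · linear_combination (norm := noncomm_ring) a * v4 * b - a * v3' * b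
  · linear_combination (norm := noncomm_ring) a * h3 * b + a * v3' * b
  · linear_combination (norm := noncomm_ring) a * h4 * b + a * v4 * b
  · have e : (1 - a * b) * (a * p * v * b) = a * ((1 - b * a) * p * v * b) := by noncomm_ring
    rw [e]
    apply qn_swap
    have e2 : (1 - b * a) * p * v * b * a = (1 - b * a) * p := by
      linear_combination (norm := noncomm_ring) (1 - b * a) * v4
    rw [e2]; exact h5

theorem pert {A : Type*} [Ring A] (s d p z : A) (h : GDP (1 - s) p z)
    (r1 : d * s * s = 0) (r2 : s * d * s = 0) (r3 : s * d * d = 0) (r4 : d * s * d = 0)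
    (r5 : d * d * s = 0) (r6 : d * d * d = 0) :
    ∃ q x, GDP (1 - s + d) q x := by
  obtain ⟨v, v1, v2, v3⟩ := gdp_v _ _ _ h
  obtain ⟨h1, h2, h3, h4, h5⟩ := h
  have v2' : v * s = s * v := by linear_combination (norm := noncomm_ring) -v2
  have h2' : p * s = s * p := by linear_combination (norm := noncomm_ring) h2
  have v3' : s * p * v = p := by linear_combination (norm := noncomm_ring) v3
  have v4 : p * v * s = p := by
    linear_combination (norm := noncomm_ring) v3' + p * v2' + h2' * v
  have v5 : s * s * p * v * v = p := by
    have : s * s * p * v * v = s * p * v := by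
      linear_combination (norm := noncomm_ring) s * v3' * v
    rw [this, v3']
  have dp : d * p = 0 := by
    rw [← v5]; linear_combination (norm := noncomm_ring) r1 * p * v * v
  have pds : p * d * s = 0 := by
    rw [← v4]; linear_combination (norm := noncomm_ring) p * v * r2
  have pdd : p * d * d = 0 := by
    rw [← v4]; linear_combination (norm := noncomm_ring) p * v * r3
  have pvds : p * v * d * s = 0 := by
    rw [← v1]; linear_combination (norm := noncomm_ring) v * pds
  have pvdd : p * v * d * d = 0 := by
    rw [← v1]; linear_combination (norm := noncomm_ring) v * pdd
  have dsz : d * s * z = d * s := by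
    have dsp : d * s * p = 0 := by
      rw [← v3']; linear_combination (norm := noncomm_ring) r1 * p * v
    linear_combination (norm := noncomm_ring) d * s * h3 - dsp + r1 * z
  have dz : d * z = d + d * s := by
    linear_combination (norm := noncomm_ring) d * h3 - dp + dsz
  have qp : (p - p * v * d) * p = p := by
    linear_combination (norm := noncomm_ring) h1 - p * v * dp
  have qc : (1 - s + d) * (p - p * v * d) = (p - p * v * d) * (1 - s + d) := by
    linear_combination (norm := noncomm_ring) h2 + dp - dp * v * d + v3' * d - pvds + pvdd
  refine ⟨p - p * v * d, (1 - (p - p * v * d)) * z * (1 - d - d * s + d * d), ?_, qc, ?_, ?_, ?_⟩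
  · linear_combination (norm := noncomm_ring) qp - qp * v * d
  · have e : (1 - s + d) * z * (1 - d - d * s + d * d) = 1 - p + p * d := by
      linear_combination (norm := noncomm_ring) h3 * (1 - d - d * s + d * d) + dz * (1 - d - d * s + d * d) + pds - pdd - r4 - r4 * s - r5 + r4 * d + r6
    have e2 : (1 - s + d) * ((1 - (p - p * v * d)) * z * (1 - d - d * s + d * d))
      = (1 - (p - p * v * d)) * ((1 - s + d) * z * (1 - d - d * s + d * d)) := by
      linear_combination (norm := noncomm_ring) - qc * z * (1 - d - d * s + d * d)
    rw [e2, e]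
    linear_combination (norm := noncomm_ring) qp - qp * d
  · have e : z * (1 - d - d * s + d * d) * (1 - s + d) = 1 - p := by
      linear_combination (norm := noncomm_ring) h4 + z * r1 - z * r4 - z * r5 + z * r6
    rw [mul_assoc, mul_assoc, ← mul_assoc z, e]
    linear_combination (norm := noncomm_ring) qp
  · have e : (1 - s + d) * (p - p * v * d) = ((1 - s) * p) * (p - p * v * d) := by
      linear_combination (norm := noncomm_ring) dp - dp * v * d - (1 - s) * h1 + (1 - s) * h1 * v * d
    rw [e]
    apply qn_swap
    have e2 : (p - p * v * d) * ((1 - s) * p) = (1 - s) * p := by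
      rw [h2]
      linear_combination (norm := noncomm_ring) qp * (1 - s)
    rw [e2]; exact h5

theorem pert' {A : Type*} [Ring A] (a b c p z : A) (h : GDP (1 - a * b) p z)
    (h1 : a * b * a * b * a = a * b * a * c * a)
    (h2 : a * b * a * c * a = a * c * a * b * a)
    (h3 : a * c * a * b * a = a * c * a * c * a) :
    ∃ q x, GDP (1 - a * c) q x := by
  have e : 1 - a * c = 1 - a * b + (a * b - a * c) := by noncomm_ring
  rw [e]
  refine pert _ _ p z h ?_ ?_ ?_ ?_ ?_ ?_
  · linear_combination (norm := noncomm_ring) h1 * b + h2 * b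
  · linear_combination (norm := noncomm_ring) h1 * b
  · linear_combination (norm := noncomm_ring) h1 * b - h1 * c
  · linear_combination (norm := noncomm_ring) h1 * b + h2 * b - h1 * c - h2 * c
  · linear_combination (norm := noncomm_ring) h1 * b - h3 * b
  · linear_combination (norm := noncomm_ring) h1 * b - h3 * b - h1 * c + h3 * c

theorem gd_smul {A : Type*} [Ring A] [Algebra ℂ A] (l : ℂ) (hl : l ≠ 0) (u x : A)
    (h : IsGDrazinInverse u x) : IsGDrazinInverse (l • u) (l⁻¹ • x) := by
  obtain ⟨h1, h2, h3⟩ := h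
  refine ⟨?_, ?_, ?_⟩
  · simp only [smul_mul_assoc, mul_smul_comm, smul_smul]
    rw [← h1]; congr 1; field_simp
  · simp only [smul_mul_assoc, mul_smul_comm, smul_smul, h2]
    congr 1; field_simp
  · have : l • u - l • u * l • u * l⁻¹ • x = l • (u - u * u * x) := by
      simp only [smul_mul_assoc, mul_smul_comm, smul_smul, smul_sub]
      congr 2; field_simp
    rw [this]
    intro y hy
    have := h3 (l • y) (by simpa only [smul_mul_assoc, mul_smul_comm] using hy)
    simpa only [smul_mul_assoc, mul_smul_comm] using this

theorem gd_scale {A : Type*} [Ring A] [Algebra ℂ A] (l : ℂ) (hl : l ≠ 0) (u : A) :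
    (∃ x, IsGDrazinInverse (l • (1 : A) - u) x) ↔ ∃ p z, GDP (1 - l⁻¹ • u) p z := by
  constructor
  · rintro ⟨x, hx⟩
    have := gd_smul l⁻¹ (inv_ne_zero hl) _ _ hx
    rw [smul_sub, smul_smul, inv_mul_cancel₀ hl, one_smul] at this
    exact ⟨_, _, gdp_of_gd _ _ this⟩
  · rintro ⟨p, z, h⟩
    have := gd_smul l hl _ _ (gd_of_gdp _ _ _ h)
    rw [smul_sub, smul_smul, mul_inv_cancel₀ hl, one_smul] at this
    exact ⟨_, this⟩

theorem generalized_jacobson_gDrazin_lambda {A : Type*} [NormedRing A]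
    [NormedAlgebra ℂ A] [CompleteSpace A] (a b c : A) (l : ℂ) (hl : l ≠ 0)
    (h1 : a * b * a * b * a = a * b * a * c * a)
    (h2 : a * b * a * c * a = a * c * a * b * a)
    (h3 : a * c * a * b * a = a * c * a * c * a) :
    (∃ x : A, IsGDrazinInverse ((l : ℂ) • (1 : A) - b * a) x) ↔
      (∃ x : A, IsGDrazinInverse ((l : ℂ) • (1 : A) - a * c) x) := by
  rw [gd_scale l hl, gd_scale l hl, ← smul_mul_assoc, ← mul_smul_comm]
  have k1 : a * (l⁻¹ • b) * a * (l⁻¹ • b) * a = a * (l⁻¹ • b) * a * (l⁻¹ • c) * a := by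
    simp only [smul_mul_assoc, mul_smul_comm, h1]
  have k2 : a * (l⁻¹ • b) * a * (l⁻¹ • c) * a = a * (l⁻¹ • c) * a * (l⁻¹ • b) * a := by
    simp only [smul_mul_assoc, mul_smul_comm, h2]
  have k3 : a * (l⁻¹ • c) * a * (l⁻¹ • b) * a = a * (l⁻¹ • c) * a * (l⁻¹ • c) * a := by
    simp only [smul_mul_assoc, mul_smul_comm, h3]
  constructor
  · rintro ⟨p, z, h⟩
    obtain ⟨q, x, h'⟩ := jac _ _ _ _ h
    exact pert' _ _ _ _ _ h' k1 k2 k3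
  · rintro ⟨p, z, h⟩
    obtain ⟨q, x, h'⟩ := pert' _ _ _ _ _ h k3.symm k2.symm k1.symm
    exact jac _ _ _ _ h'
end

section
/- Let A be a unital ring and a, b, c ∈ A satisfy a(ba)² = abaca = acaba = (ac)²a. If 1 - ba has a group inverse, then 1 - ac has a group inverse. -/
/-- `x` is a group inverse of `u`. -/
def IsGroupInverse {A : Type*} [Ring A] (u x : A) : Prop :=
  u = u * x * u ∧ x = x * u * x ∧ u * x = x * u

theorem generalized_jacobson_group_inverse {A : Type*} [Ring A] (a b c : A)
    (h1 : a * b * a * b * a = a * b * a * c * a)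
    (h2 : a * b * a * c * a = a * c * a * b * a)
    (h3 : a * c * a * b * a = a * c * a * c * a)
    (h : ∃ x : A, IsGroupInverse (1 - b * a) x) :
    ∃ x : A, IsGroupInverse (1 - a * c) x := by
  obtain ⟨y, hy1, hy2, hy3⟩ := h
  have hc : y * (b * a) = b * a * y := by
    have e1 : (1 - b * a) * y = y - b * a * y := by noncomm_ring
    have e2 : y * (1 - b * a) = y - y * (b * a) := by noncomm_ring
    rw [e1, e2] at hy3
    exact (sub_right_injective hy3).symm
  obtain ⟨e, he⟩ : ∃ e, e = 1 - y * (1 - b * a) := ⟨_, rfl⟩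
  have heR : e * (b * a) = e := by
    have : e * (1 - b * a) = 0 := by
      rw [he, sub_mul, one_mul, ← hy3, ← hy1, sub_self]
    rw [mul_sub, mul_one, sub_eq_zero] at this
    exact this.symm
  have hyu : y * (1 - b * a) = 1 - e := by rw [he]; abel
  have huy : (1 - b * a) * y = 1 - e := by rw [hy3, hyu]
  -- f kills 1 - ac
  have hf : (a * e * b * a * c) * (1 - a * c) = 0 := by
    have t : e * b * a * c * a * c = e * b * a * c := by
      calc e * b * a * c * a * c = (e * (b * a)) * b * a * c * a * c := by rw [heR]
        _ = e * b * (a * b * a * c * a) * c := by noncomm_ring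
        _ = e * b * (a * b * a * b * a) * c := by rw [h1]
        _ = (e * (b * a)) * (b * a) * b * a * c := by noncomm_ring
        _ = e * b * a * c := by rw [heR, heR]
    calc (a * e * b * a * c) * (1 - a * c) = a * (e * b * a * c) - a * (e * b * a * c * a * c) := by
          noncomm_ring
      _ = 0 := by rw [t, sub_self]
  have s3 : a * c * a * c * a * c = a * b * a * b * a * c := by rw [h1, h2, h3]
  have k1 : (a * y * b * a * b * a * c) * (1 - a * c)
      = a * b * a * b * a * c - a * e * b * a * c := by
    calc (a * y * b * a * b * a * c) * (1 - a * c)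
        = a * y * b * a * b * a * c - a * y * b * (a * b * a * c * a) * c := by noncomm_ring
      _ = a * y * b * a * b * a * c - a * y * b * (a * b * a * b * a) * c := by rw [h1]
      _ = a * (y * (1 - b * a)) * (b * a) * b * a * c := by noncomm_ring
      _ = a * b * a * b * a * c - a * (e * (b * a)) * b * a * c := by rw [hyu]; noncomm_ring
      _ = _ := by rw [heR]
  have heL : b * a * e = e := by
    have : (1 - b * a) * e = 0 := by
      rw [he, mul_sub, mul_one, ← mul_assoc, ← hy1, sub_self]
    rw [sub_mul, one_mul, sub_eq_zero] at this
    exact this.symm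
  have k2 : (1 - a * c) * (a * y * b * a * b * a * c)
      = a * b * a * b * a * c - a * e * b * a * c := by
    calc (1 - a * c) * (a * y * b * a * b * a * c)
        = (1 - a * c) * a * (y * (b * a)) * b * a * c := by noncomm_ring
      _ = (1 - a * c) * a * (b * a * y) * b * a * c := by rw [hc]
      _ = a * b * a * y * b * a * c - (a * c * a * b * a) * y * b * a * c := by noncomm_ring
      _ = a * b * a * y * b * a * c - (a * b * a * b * a) * y * b * a * c := by rw [h1, h2]
      _ = a * (b * a) * ((1 - b * a) * y) * b * a * c := by noncomm_ring
      _ = a * b * a * b * a * c - a * (b * a * e) * b * a * c := by rw [huy]; noncomm_ring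
      _ = _ := by rw [heL]
  obtain ⟨w, hw⟩ : ∃ w, w = 1 + a * c + a * c * a * c + a * y * b * a * b * a * c := ⟨_, rfl⟩
  have w1 : w * (1 - a * c) = 1 - a * e * b * a * c := by
    calc w * (1 - a * c) = 1 - a * c * a * c * a * c
          + (a * y * b * a * b * a * c) * (1 - a * c) := by rw [hw]; noncomm_ring
      _ = _ := by rw [k1, s3]; abel
  have w2 : (1 - a * c) * w = 1 - a * e * b * a * c := by
    calc (1 - a * c) * w = 1 - a * c * a * c * a * c
          + (1 - a * c) * (a * y * b * a * b * a * c) := by rw [hw]; noncomm_ring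
      _ = _ := by rw [k2, s3]; abel
  have hv : (1 - a * c) * w * (1 - a * c) = 1 - a * c := by
    rw [w2, sub_mul, hf, one_mul, sub_zero]
  have hcm : (1 - a * c) * w = w * (1 - a * c) := by rw [w1, w2]
  generalize 1 - a * c = v at hv hcm
  refine ⟨w * v * w, ?_, ?_, ?_⟩
  · calc v = v * w * v := hv.symm
      _ = (v * w * v) * w * v := by rw [hv, hv]
      _ = _ := by noncomm_ring
  · calc w * v * w = w * (v * w * v) * w := by rw [hv]
      _ = w * ((v * w * v) * w * v) * w := by rw [hv, hv]
      _ = _ := by noncomm_ring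
  · calc v * (w * v * w) = (v * w * v) * w := by noncomm_ring
      _ = w * (v * w * v) := by rw [hv, hcm]
      _ = _ := by noncomm_ring
end
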